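/- arXiv:2212.03912 — 3 statements merged into one kernel-verified Lean document; each statement's English description precedes it below -/
import Mathlib

section
/- Let k be a natural number with k > 2. Then every k-regular simple graph G on 2k+1 vertices contains three mutually adjacent vertices (a triangle); equivalently, the girth of G equals 3. -/
namespace SimpleGraph

variable {V : Type*} {G : SimpleGraph V}

/-- A regular bipartite graph of positive degree has an even number of vertices. -/
theorem IsRegularOfDegree.even_card_of_isBipartite [Fintype V] [DecidableRel G.Adj] {k : ℕ}
    (hreg : G.IsRegularOfDegree k) (hk : 0 < k) (hG : G.IsBipartite) :
    Even (Fintype.card V) := by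
  obtain ⟨c⟩ := hG
  let s : Finset V := {v | c v = 0}
  let t : Finset V := {v | ¬ c v = 0}
  have hst : G.IsBipartiteWith (s : Set V) (t : Set V) := by
    refine ⟨Finset.disjoint_coe.2 (Finset.disjoint_filter_filter_not _ _ _), fun v w h ↦ ?_⟩
    have := c.valid h
    simp only [s, t, Finset.coe_filter, Finset.mem_univ, true_and, Set.mem_ofPred_eq]
    omega
  have hsum := isBipartiteWith_sum_degrees_eq hst
  simp only [hreg.degree_eq, Finset.sum_const, smul_eq_mul] at hsum
  have hcard : s.card + t.card = Fintype.card V :=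
    Finset.card_filter_add_card_filter_not _
  exact ⟨s.card, by rw [← hcard, Nat.eq_of_mul_eq_mul_right hk hsum]⟩

/-- A graph with a triangle has girth three. -/
theorem girth_eq_three_of_not_cliqueFree (h : ¬ G.CliqueFree 3) : G.girth = 3 := by
  classical
  obtain ⟨s, hs⟩ := not_forall_not.1 h
  obtain ⟨u, w, hw, hlen⟩ := is3Clique_iff_exists_cycle_length_three.1 ⟨s, hs⟩
  exact le_antisymm (hlen ▸ girth_le_length hw) (three_le_girth fun hG ↦ hG w hw)

end SimpleGraph

/-- If `k > 2`, then every `k`-regular simple graph on `2k+1` vertices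
contains three mutually adjacent vertices (a triangle); equivalently, its girth is `3`. -/
theorem regular_graph_on_two_k_add_one_has_triangle
    (k : ℕ) (hk : 2 < k) {V : Type*} [Fintype V]
    (hV : Fintype.card V = 2 * k + 1)
    (G : SimpleGraph V) [DecidableRel G.Adj] (hreg : G.IsRegularOfDegree k) :
    (∃ a b c : V, G.Adj a b ∧ G.Adj a c ∧ G.Adj b c) ∧ G.girth = 3 := by
  classical
  have : Nonempty V := Fintype.card_pos_iff.1 (by omega)
  have htri : ¬ G.CliqueFree 3 := by
    intro hfree
    have hbip : G.IsBipartite := by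
      refine SimpleGraph.colorable_of_cliqueFree_lt_minDegree hfree ?_
      rw [hreg.minDegree_eq, hV]
      omega
    have heven := hreg.even_card_of_isBipartite (by omega) hbip
    rw [hV] at heven
    exact Nat.not_even_two_mul_add_one k heven
  refine ⟨?_, SimpleGraph.girth_eq_three_of_not_cliqueFree htri⟩
  obtain ⟨s, hs⟩ := not_forall_not.1 htri
  obtain ⟨a, b, c, hab, hac, hbc, -⟩ := SimpleGraph.is3Clique_iff.1 hs
  exact ⟨a, b, c, hab, hac, hbc⟩
end

section
/- Let h_1, …, h_m be integers with h_i ≥ 3 for every i and h_1 + ⋯ + h_m = n, and let G be the disjoint union of the cycles C_{h_1}, …, C_{h_m} (a graph on n vertices). Then the number of triangles (3-element sets of mutually adjacent vertices) in the complement of G equals C(n,3) − Σ_i f_n(h_i), where f_n(h) = h(n−3) + 1 if h = 3 and f_n(h) = h(n−3) if h > 3, and C(n,3) denotes the binomial coefficient n choose 3. -/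
open Finset

/-- The disjoint union of the cycles `C_{h 0}, …, C_{h (m-1)}`, as a simple graph on the
sigma type `Σ i : Fin m, Fin (h i)`: two vertices are adjacent iff they lie in the same
component and are adjacent in the corresponding cycle graph. -/
def cycleUnion (m : ℕ) (h : Fin m → ℕ) : SimpleGraph (Σ i : Fin m, Fin (h i)) :=
  SimpleGraph.fromRel fun x y =>
    ∃ e : x.1 = y.1, (SimpleGraph.cycleGraph (h y.1)).Adj (Fin.cast (congrArg h e) x.2) y.2

theorem exists_eq_insert_of_card_eq_three {V : Type*} [DecidableEq V] {s : Finset V}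
    (hs : #s = 3) {a b : V} (ha : a ∈ s) (hb : b ∈ s) (hab : a ≠ b) :
    ∃ c, c ≠ a ∧ c ≠ b ∧ s = {a, b, c} := by
  obtain ⟨x, y, z, hxy, hxz, hyz, rfl⟩ := Finset.card_eq_three.1 hs
  simp only [mem_insert, mem_singleton] at ha hb
  rcases ha with rfl | rfl | rfl <;> rcases hb with rfl | rfl | rfl
  · exact absurd rfl hab
  · exact ⟨z, hxz.symm, hyz.symm, rfl⟩
  · exact ⟨y, hxy.symm, hyz, by grind⟩
  · exact ⟨z, hyz.symm, hxz.symm, by grind⟩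
  · exact absurd rfl hab
  · exact ⟨x, hxy, hxz, by grind⟩
  · exact ⟨y, hyz, hxy.symm, by grind⟩
  · exact ⟨x, hxz, hxy, by grind⟩
  · exact absurd rfl hab

/-- In a graph whose edges join each `x` to `σ x`, the `3`-sets that are neither independent nor
triangles are uniquely of the form `{x, σ x, w}` with `w` not among `x`, `σ x`, `σ⁻¹ x`. -/
theorem card_mixed_triples {V : Type*} [Fintype V] [DecidableEq V] (σ : Equiv.Perm V)
    (hσ : ∀ x, σ x ≠ x) (hσ' : ∀ x, σ (σ x) ≠ x) (G : SimpleGraph V) [DecidableRel G.Adj]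
    (hG : ∀ x y, G.Adj x y ↔ y = σ x ∨ x = σ y) :
    #{s ∈ powersetCard 3 (univ : Finset V) | ¬ G.IsNClique 3 s ∧ ¬ Gᶜ.IsNClique 3 s} =
      Fintype.card V * (Fintype.card V - 3) := by
  have hfiber : ∀ x, #({x, σ x, σ.symm x}ᶜ : Finset V) = Fintype.card V - 3 := by
    intro x
    rw [card_compl, card_eq_three.2]
    refine ⟨x, σ x, σ.symm x, (hσ x).symm, ?_, ?_, rfl⟩
    · intro e
      exact hσ x (by rw [Equiv.eq_symm_apply] at e; exact e)
    · intro e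
      exact hσ' x (by rw [Equiv.eq_symm_apply] at e; exact e)
  have hcount : #((univ : Finset V).sigma fun x => ({x, σ x, σ.symm x}ᶜ : Finset V)) =
      Fintype.card V * (Fintype.card V - 3) := by
    simp only [card_sigma, hfiber, sum_const, smul_eq_mul, card_univ]
  rw [← hcount]
  symm
  have hmem : ∀ x w : V, w ∈ ({x, σ x, σ.symm x}ᶜ : Finset V) ↔
      w ≠ x ∧ w ≠ σ x ∧ σ w ≠ x := by
    intro x w
    simp [Equiv.eq_symm_apply]
  have hinj : ∀ x y, σ x = σ y → x = y := fun x y e => σ.injective e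
  refine card_bij (fun p _ => {p.1, σ p.1, p.2}) ?_ ?_ ?_
  · rintro ⟨x, w⟩ hp
    simp only [mem_sigma, mem_univ, true_and, hmem] at hp
    obtain ⟨h1, h2, h3⟩ := hp
    simp only [mem_filter, mem_powersetCard, subset_univ, true_and]
    refine ⟨card_eq_three.2 ⟨_, _, _, (hσ x).symm, h1.symm, h2.symm, rfl⟩, fun hc => ?_,
      fun hc => ?_⟩
    · have := hc.isClique (x := x) (by simp) (y := w) (by simp) h1.symm
      rw [hG] at this
      grind
    · have := hc.isClique (x := x) (by simp) (y := σ x) (by simp) (hσ x).symm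
      rw [SimpleGraph.compl_adj, hG] at this
      grind
  · rintro ⟨x, w⟩ hp ⟨y, z⟩ hq e
    simp only [mem_sigma, mem_univ, true_and, hmem] at hp hq
    have hx := hσ x
    have hy := hσ y
    have hx' := hσ' x
    have hy' := hσ' y
    have e1 : x ∈ ({y, σ y, z} : Finset V) := by rw [← e]; simp
    have e2 : σ x ∈ ({y, σ y, z} : Finset V) := by rw [← e]; simp
    have e3 : w ∈ ({y, σ y, z} : Finset V) := by rw [← e]; simp
    have e4 : y ∈ ({x, σ x, w} : Finset V) := by rw [e]; simp
    have e5 : σ y ∈ ({x, σ x, w} : Finset V) := by rw [e]; simp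
    have e6 : z ∈ ({x, σ x, w} : Finset V) := by rw [e]; simp
    simp only [mem_insert, mem_singleton] at e1 e2 e3 e4 e5 e6
    have hi := hinj x y
    have : x = y ∧ w = z := by grind
    rw [this.1, this.2]
  · intro s hs
    simp only [mem_filter, mem_powersetCard, subset_univ, true_and] at hs
    obtain ⟨hs3, hT, hA⟩ := hs
    obtain ⟨x, hx, hx'⟩ : ∃ x ∈ s, σ x ∈ s := by
      by_contra! hno
      refine hA ⟨fun a ha b hb hab => ?_, hs3⟩
      rw [SimpleGraph.compl_adj, hG]
      grind
    obtain ⟨w, hw, hw', rfl⟩ := exists_eq_insert_of_card_eq_three hs3 hx hx' (hσ x).symm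
    by_cases hwx : σ w = x
    · refine ⟨⟨w, σ x⟩, ?_, ?_⟩
      · simp only [mem_sigma, mem_univ, true_and, hmem]
        refine ⟨hw'.symm, hwx ▸ hσ x, fun e => hT ?_⟩
        rw [SimpleGraph.is3Clique_iff]
        exact ⟨x, σ x, w, by grind, by grind, by grind, rfl⟩
      · grind
    · exact ⟨⟨x, w⟩, by simpa only [mem_sigma, mem_univ, true_and, hmem] using ⟨hw, hw', hwx⟩, rfl⟩

theorem card_triangles_compl_add {V : Type*} [Fintype V] [DecidableEq V] (σ : Equiv.Perm V)
    (hσ : ∀ x, σ x ≠ x) (hσ' : ∀ x, σ (σ x) ≠ x) (G : SimpleGraph V) [DecidableRel G.Adj]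
    (hG : ∀ x y, G.Adj x y ↔ y = σ x ∨ x = σ y) :
    #(Gᶜ.cliqueFinset 3) +
      (Fintype.card V * (Fintype.card V - 3) + #(G.cliqueFinset 3)) =
      (Fintype.card V).choose 3 := by
  have hfilter : ∀ (H : SimpleGraph V) [DecidableRel H.Adj],
      H.cliqueFinset 3 = {s ∈ powersetCard 3 (univ : Finset V) | H.IsNClique 3 s} := by
    intro H _
    ext s
    simp only [SimpleGraph.mem_cliqueFinset_iff, mem_filter, mem_powersetCard, subset_univ,
      true_and]
    exact ⟨fun hs => ⟨hs.card_eq, hs⟩, fun hs => hs.2⟩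
  have hdisj : ∀ s, Gᶜ.IsNClique 3 s → ¬ G.IsNClique 3 s := by
    intro s h1 h2
    obtain ⟨a, b, c, hab, -, -, rfl⟩ := SimpleGraph.is3Clique_iff.1 h2
    have := h1.isClique (x := a) (by simp) (y := b) (by simp) hab.ne
    exact this.2 hab
  rw [← card_mixed_triples σ hσ hσ' G hG, hfilter, hfilter, ← card_univ (α := V),
    ← card_powersetCard, ← card_union_of_disjoint, ← card_union_of_disjoint]
  · congr 1
    ext s
    simp only [mem_union, mem_filter]
    tauto
  · rw [disjoint_left]
    intro s
    simp only [mem_union, mem_filter]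
    have := hdisj s
    tauto
  · rw [disjoint_left]
    intro s
    simp only [mem_filter]
    tauto

theorem val_finRotate {n : ℕ} (a : Fin n) :
    (finRotate n a : ℕ) = if (a : ℕ) + 1 = n then 0 else (a : ℕ) + 1 := by
  cases n with
  | zero => exact a.elim0
  | succ n =>
    rw [coe_finRotate]
    simp [Fin.ext_iff]

theorem cycleGraph_adj_iff_finRotate {n : ℕ} (hn : 2 ≤ n) (a b : Fin n) :
    (SimpleGraph.cycleGraph n).Adj a b ↔ b = finRotate n a ∨ a = finRotate n b := by
  obtain ⟨k, rfl⟩ := Nat.exists_eq_add_of_le' hn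
  rw [SimpleGraph.cycleGraph_adj, finRotate_apply, finRotate_apply, sub_eq_iff_eq_add',
    sub_eq_iff_eq_add', or_comm, add_comm b, add_comm a]

theorem cycleUnion_adj_iff (m : ℕ) (h : Fin m → ℕ) (hh : ∀ i, 2 ≤ h i)
    (x y : Σ i : Fin m, Fin (h i)) :
    (cycleUnion m h).Adj x y ↔
      y = Equiv.sigmaCongrRight (fun i => finRotate (h i)) x ∨
      x = Equiv.sigmaCongrRight (fun i => finRotate (h i)) y := by
  obtain ⟨i, a⟩ := x
  obtain ⟨j, b⟩ := y
  rw [cycleUnion, SimpleGraph.fromRel_adj]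
  by_cases hij : i = j
  · subst hij
    have := cycleGraph_adj_iff_finRotate (hh i) a b
    have hne : (SimpleGraph.cycleGraph (h i)).Adj a b → a ≠ b := fun e => e.ne
    have hsymm := (SimpleGraph.cycleGraph (h i)).adj_comm a b
    simp only [exists_prop_of_true, Fin.cast_eq_self, ne_eq, Sigma.mk.injEq, heq_eq_eq, true_and,
      Equiv.sigmaCongrRight_apply]
    tauto
  · have hji : j ≠ i := fun e => hij e.symm
    simp [Sigma.ext_iff, hij, hji]

/-- The triangles of a disjoint union of cycles are its components of size three. -/
theorem card_triangles_cycleUnion (m : ℕ) (h : Fin m → ℕ) (hh : ∀ i, 3 ≤ h i)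
    [DecidableRel (cycleUnion m h).Adj] :
    #((cycleUnion m h).cliqueFinset 3) = #{i | h i = 3} := by
  have hadj := cycleUnion_adj_iff m h fun i => (hh i).trans' (by norm_num)
  symm
  refine card_bij (fun i _ => univ.map (Function.Embedding.sigmaMk i)) ?_ ?_ ?_
  · intro i hi
    simp only [mem_filter, mem_univ, true_and] at hi
    rw [SimpleGraph.mem_cliqueFinset_iff]
    refine ⟨?_, by simp [hi]⟩
    intro x hx y hy hxy
    simp only [coe_map, coe_univ, Set.image_univ, Set.mem_range] at hx hy
    obtain ⟨a, rfl⟩ := hx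
    obtain ⟨b, rfl⟩ := hy
    rw [hadj]
    have hab : a ≠ b := by rintro rfl; exact hxy rfl
    simp only [Function.Embedding.sigmaMk_apply, Equiv.sigmaCongrRight_apply,
      Sigma.mk.injEq, heq_eq_eq, true_and, Fin.ext_iff, val_finRotate]
    rw [ne_eq, Fin.ext_iff] at hab
    split_ifs <;> omega
  · intro i hi j hj e
    have hx : (⟨i, ⟨0, by have := hh i; omega⟩⟩ : Σ i : Fin m, Fin (h i)) ∈
        univ.map (Function.Embedding.sigmaMk j) := by
      rw [← e]; simp
    simp only [mem_map, mem_univ, true_and, Function.Embedding.sigmaMk_apply] at hx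
    obtain ⟨b, hb⟩ := hx
    exact (congrArg Sigma.fst hb).symm
  · intro s hs
    rw [SimpleGraph.mem_cliqueFinset_iff] at hs
    obtain ⟨⟨i, a⟩, ⟨j, b⟩, ⟨k, c⟩, hab, hac, hbc, rfl⟩ := SimpleGraph.is3Clique_iff.1 hs
    have hfst : ∀ x y, (cycleUnion m h).Adj x y → x.1 = y.1 := by
      intro x y e
      rcases (hadj x y).1 e with rfl | rfl <;> rfl
    obtain rfl : i = j := hfst _ _ hab
    obtain rfl : i = k := hfst _ _ hac
    have hab' := hab.ne
    have hac' := hac.ne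
    have hbc' := hbc.ne
    rw [hadj] at hab hac hbc
    simp only [Equiv.sigmaCongrRight_apply, ne_eq,
      Sigma.mk.injEq, heq_eq_eq, true_and, Fin.ext_iff, val_finRotate] at hab hac hbc hab' hac' hbc'
    have hi : h i = 3 := by
      have := hh i
      split_ifs at hab hac hbc <;> omega
    refine ⟨i, by simpa using hi, ?_⟩
    symm
    refine eq_of_subset_of_card_le ?_ ?_
    · intro x hx
      simp only [mem_insert, mem_singleton] at hx
      rcases hx with rfl | rfl | rfl <;> simp
    · rw [hs.card_eq]
      simp [hi]

/-- If `h 0 + ⋯ + h (m-1) = n` with every `h i ≥ 3` and `G` is the disjoint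
union of the cycles `C_{h i}`, then the number of triangles in the complement of `G` equals
`C(n,3) - Σ_i f_n (h i)`, where `f_n h = h (n-3) + 1` if `h = 3` and `f_n h = h (n-3)`
otherwise. -/
theorem card_triangles_compl_cycleUnion
    (n m : ℕ) (h : Fin m → ℕ) (hh : ∀ i, 3 ≤ h i) (hsum : ∑ i, h i = n) :
    ((cycleUnion m h)ᶜ.cliqueSet 3).ncard =
      Nat.choose n 3 - ∑ i, (h i * (n - 3) + if h i = 3 then 1 else 0) := by
  classical
  set σ := Equiv.sigmaCongrRight fun i => finRotate (h i)
  have hadj : ∀ x y, (cycleUnion m h).Adj x y ↔ y = σ x ∨ x = σ y :=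
    cycleUnion_adj_iff m h fun i => (hh i).trans' (by norm_num)
  have hσ : ∀ x, σ x ≠ x := by
    rintro ⟨i, a⟩ e
    have hi := hh i
    simp only [σ, Equiv.sigmaCongrRight_apply, Sigma.mk.injEq, heq_eq_eq, true_and, Fin.ext_iff,
      val_finRotate] at e
    split_ifs at e <;> omega
  have hσ' : ∀ x, σ (σ x) ≠ x := by
    rintro ⟨i, a⟩ e
    have hi := hh i
    simp only [σ, Equiv.sigmaCongrRight_apply, Sigma.mk.injEq, heq_eq_eq, true_and, Fin.ext_iff,
      val_finRotate] at e
    split_ifs at e <;> omega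
  have key := card_triangles_compl_add σ hσ hσ' (cycleUnion m h) hadj
  have hcard : Fintype.card (Σ i : Fin m, Fin (h i)) = n := by simp [hsum]
  rw [card_triangles_cycleUnion m h hh, hcard] at key
  rw [Finset.sum_add_distrib, ← Finset.sum_mul, hsum, ← Finset.card_filter,
    ← SimpleGraph.coe_cliqueFinset, Set.ncard_coe_finset]
  omega
end

section
/- Let n ≥ 3 and write n = 3k + r with 0 ≤ r < 3 and, when r = 0, k = n/3 (so that k ≥ 1 and 3(k−1) + (3+r) = n). Among all disjoint unions of cycles C_{h_1} ∪ ⋯ ∪ C_{h_m} with every h_i ≥ 3 and h_1 + ⋯ + h_m = n, the graph G₀ consisting of k−1 copies of C_3 together with one copy of C_{3+r} is such that the complement of G₀ has the minimum possible number of triangles: for every such disjoint union G, the number of triangles in the complement of G₀ is at most the number of triangles in the complement of G. -/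
open Finset

namespace SimpleGraph

open Classical in
/-- In a set of three vertices that spans neither a triangle nor an independent set, exactly two
vertices see one neighbour and one non-neighbour. -/
lemma sum_adj_compl_adj_of_card_eq_three {V : Type*} (G : SimpleGraph V) (s : Finset V)
    (hs : #s = 3) :
    ∑ v ∈ s, ∑ a ∈ s, ∑ b ∈ s, (if G.Adj v a ∧ Gᶜ.Adj v b then 1 else 0)
      + 2 * (if G.IsNClique 3 s then 1 else 0) + 2 * (if Gᶜ.IsNClique 3 s then 1 else 0) = 2 := by
  obtain ⟨x, y, z, hxy, hxz, hyz, rfl⟩ := Finset.card_eq_three.mp hs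
  have hx : x ∉ ({y, z} : Finset V) := by simp [hxy, hxz]
  have hy : y ∉ ({z} : Finset V) := by simp [hyz]
  simp only [is3Clique_triple_iff, Finset.sum_insert hx, Finset.sum_insert hy,
    Finset.sum_singleton, compl_adj, G.adj_comm y x, G.adj_comm z x, G.adj_comm z y]
  by_cases h₁ : G.Adj x y <;> by_cases h₂ : G.Adj x z <;> by_cases h₃ : G.Adj y z <;>
    simp [h₁, h₂, h₃, hxy, hxz, hyz, hxy.symm, hxz.symm, hyz.symm]

open Classical in
/-- **Goodman's formula** for the number of triangles in a graph and its complement. -/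
theorem sum_degree_mul_degree_compl_add_ncard_cliqueSet {V : Type*} [Fintype V]
    (G : SimpleGraph V) :
    ∑ v, G.degree v * Gᶜ.degree v + 2 * (G.cliqueSet 3).ncard + 2 * (Gᶜ.cliqueSet 3).ncard
      = 2 * (Fintype.card V).choose 3 := by
  have hclique (H : SimpleGraph V) [DecidablePred (H.IsNClique 3)] :
      ∑ s ∈ powersetCard 3 univ, (if H.IsNClique 3 s then 1 else 0) = (H.cliqueSet 3).ncard := by
    rw [← Finset.card_filter, ← Set.ncard_coe_finset]
    congr 1
    ext s
    simp only [coe_filter, mem_powersetCard_univ, Set.mem_ofPred_eq, mem_cliqueSet_iff]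
    exact ⟨fun h => h.2, fun h => ⟨h.card_eq, h⟩⟩
  have hpair (v : V) : ∑ a, ∑ b, (if G.Adj v a ∧ Gᶜ.Adj v b then 1 else 0)
      = G.degree v * Gᶜ.degree v := by
    simp_rw [← card_neighborFinset_eq_degree, neighborFinset_eq_filter, Finset.card_filter,
      Finset.sum_mul_sum, ite_and, ite_mul, mul_ite]
    simp
  have hcherry : ∑ s ∈ powersetCard 3 (univ : Finset V),
      ∑ v ∈ s, ∑ a ∈ s, ∑ b ∈ s, (if G.Adj v a ∧ Gᶜ.Adj v b then 1 else 0)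
      = ∑ v, G.degree v * Gᶜ.degree v := by
    have hmem (s : Finset V) :
        ∑ v ∈ s, ∑ a ∈ s, ∑ b ∈ s, (if G.Adj v a ∧ Gᶜ.Adj v b then 1 else 0)
        = ∑ v, ∑ a, ∑ b, if (G.Adj v a ∧ Gᶜ.Adj v b) ∧ {v, a, b} ⊆ s then 1 else 0 := by
      rw [← Finset.sum_subset (subset_univ s)]
      · refine Finset.sum_congr rfl fun v hv => ?_
        rw [← Finset.sum_subset (subset_univ s)]
        · refine Finset.sum_congr rfl fun a ha => ?_
          rw [← Finset.sum_subset (subset_univ s)]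
          · refine Finset.sum_congr rfl fun b hb => ?_
            simp [insert_subset_iff, hv, ha, hb]
          · intro b _ hb
            simp [insert_subset_iff, hb]
        · intro a _ ha
          simp [insert_subset_iff, ha]
      · intro v _ hv
        simp [insert_subset_iff, hv]
    simp_rw [hmem]
    rw [Finset.sum_comm]
    refine Finset.sum_congr rfl fun v _ => ?_
    rw [Finset.sum_comm, ← hpair]
    refine Finset.sum_congr rfl fun a _ => ?_
    rw [Finset.sum_comm]
    refine Finset.sum_congr rfl fun b _ => ?_
    by_cases h : G.Adj v a ∧ Gᶜ.Adj v b
    · have hab : a ≠ b := by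
        rintro rfl
        exact ((compl_adj G v a).mp h.2).2 h.1
      have hcard : #({v, a, b} : Finset V) = 3 :=
        Finset.card_eq_three.mpr ⟨v, a, b, h.1.ne, h.2.ne, hab, rfl⟩
      rw [Finset.sum_eq_single_of_mem {v, a, b} (by simp [hcard])]
      · simp [h]
      · intro s hs hne
        rw [if_neg]
        rintro ⟨-, hsub⟩
        exact hne (Finset.eq_of_subset_of_card_le hsub
          (by rw [hcard, (mem_powersetCard_univ.mp hs)])).symm
    · simp only [h, false_and, if_false, sum_const_zero]
  rw [← hcherry, ← hclique, ← hclique, Finset.mul_sum, Finset.mul_sum, ← Finset.sum_add_distrib,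
    ← Finset.sum_add_distrib, Finset.sum_congr rfl fun s hs =>
      sum_adj_compl_adj_of_card_eq_three G s (mem_powersetCard_univ.mp hs)]
  simp [mul_comm]

open Classical in
lemma IsRegularOfDegree.ncard_cliqueSet_add_ncard_cliqueSet_compl {V : Type*} [Fintype V]
    {G : SimpleGraph V} {d : ℕ} (hG : G.IsRegularOfDegree d) :
    Fintype.card V * (d * (Fintype.card V - 1 - d)) + 2 * (G.cliqueSet 3).ncard
      + 2 * (Gᶜ.cliqueSet 3).ncard = 2 * (Fintype.card V).choose 3 := by
  rw [← sum_degree_mul_degree_compl_add_ncard_cliqueSet G]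
  simp [degree_compl, hG.degree_eq]

lemma cycleGraph_adj_val {n : ℕ} {x y : Fin n} (h : (cycleGraph n).Adj x y) :
    x.val + 1 = y.val ∨ y.val + 1 = x.val ∨ (x.val = 0 ∧ y.val + 1 = n) ∨
      (y.val = 0 ∧ x.val + 1 = n) := by
  rw [cycleGraph_adj'] at h
  rcases le_total x y with hxy | hxy
  all_goals
    rcases hxy.eq_or_lt with rfl | hlt
    · simp [Fin.coe_sub_iff_le.mpr le_rfl] at h
    · rw [Fin.coe_sub_iff_lt.mpr hlt, Fin.coe_sub_iff_le.mpr hxy] at h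
      omega

lemma eq_three_of_cycleGraph_triangle {n : ℕ} (hn : 3 ≤ n) {x y z : Fin n}
    (hxy : (cycleGraph n).Adj x y) (hxz : (cycleGraph n).Adj x z)
    (hyz : (cycleGraph n).Adj y z) : n = 3 := by
  have h₁ := cycleGraph_adj_val hxy
  have h₂ := cycleGraph_adj_val hxz
  have h₃ := cycleGraph_adj_val hyz
  omega

end SimpleGraph

section CycleUnion

variable {m : ℕ} {h : Fin m → ℕ}

lemma cycleUnion_adj_mk {i : Fin m} {a b : Fin (h i)} :
    (cycleUnion m h).Adj ⟨i, a⟩ ⟨i, b⟩ ↔ (SimpleGraph.cycleGraph (h i)).Adj a b := by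
  simp only [cycleUnion, SimpleGraph.fromRel_adj, exists_true_left, Fin.cast_eq_self, ne_eq,
    Sigma.mk.injEq, heq_eq_eq, true_and]
  rw [SimpleGraph.adj_comm _ b a, or_self, and_iff_right_iff_imp]
  exact fun hab => hab.ne

lemma fst_eq_of_cycleUnion_adj {x y : Σ i : Fin m, Fin (h i)} (hxy : (cycleUnion m h).Adj x y) :
    x.1 = y.1 := by
  rcases hxy with ⟨-, ⟨e, -⟩ | ⟨e, -⟩⟩
  exacts [e, e.symm]

open Classical in
lemma cycleUnion_isRegularOfDegree (hh : ∀ i, 3 ≤ h i) :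
    (cycleUnion m h).IsRegularOfDegree 2 := by
  rintro ⟨i, a⟩
  have hnbr : (cycleUnion m h).neighborFinset ⟨i, a⟩
      = ((SimpleGraph.cycleGraph (h i)).neighborFinset a).map (Function.Embedding.sigmaMk i) := by
    ext ⟨j, b⟩
    rw [SimpleGraph.mem_neighborFinset]
    constructor
    · intro hab
      obtain rfl : i = j := fst_eq_of_cycleUnion_adj hab
      simpa using cycleUnion_adj_mk.mp hab
    · simp only [mem_map, SimpleGraph.mem_neighborFinset]
      rintro ⟨c, hc, hcb⟩
      rw [← hcb]
      exact cycleUnion_adj_mk.mpr hc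
  rw [← SimpleGraph.card_neighborFinset_eq_degree, hnbr, card_map]
  have hdeg : ∀ n, 3 ≤ n → ∀ c : Fin n, #((SimpleGraph.cycleGraph n).neighborFinset c) = 2 := by
    intro n hn c
    obtain ⟨n, rfl⟩ := Nat.exists_eq_add_of_le' hn
    rw [SimpleGraph.card_neighborFinset_eq_degree]
    convert SimpleGraph.cycleGraph_degree_three_le (v := c)
  exact hdeg _ (hh i) a

lemma cycleUnion_cliqueSet_three (hh : ∀ i, 3 ≤ h i) :
    (cycleUnion m h).cliqueSet 3
      = (fun i => univ.map (Function.Embedding.sigmaMk i)) '' {i | h i = 3} := by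
  classical
  ext s
  rw [SimpleGraph.mem_cliqueSet_iff, Set.mem_image]
  constructor
  · intro hs
    obtain ⟨⟨i, a⟩, ⟨j, b⟩, ⟨l, c⟩, hab, hac, hbc, hs'⟩ := SimpleGraph.is3Clique_iff.mp hs
    obtain rfl : i = j := fst_eq_of_cycleUnion_adj hab
    obtain rfl : i = l := fst_eq_of_cycleUnion_adj hac
    have hi := SimpleGraph.eq_three_of_cycleGraph_triangle (hh i) (cycleUnion_adj_mk.mp hab)
      (cycleUnion_adj_mk.mp hac) (cycleUnion_adj_mk.mp hbc)
    refine ⟨i, hi, (Finset.eq_of_subset_of_card_le ?_ ?_).symm⟩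
    · simp [hs', insert_subset_iff]
    · simp [hs.card_eq, hi]
  · rintro ⟨i, hi, rfl⟩
    refine ⟨?_, by simpa using hi⟩
    have hadj : ∀ n, n = 3 → ∀ a b : Fin n, a ≠ b → (SimpleGraph.cycleGraph n).Adj a b := by
      rintro _ rfl
      simp [SimpleGraph.cycleGraph_three_eq_top]
    intro x hx y hy hxy
    simp only [coe_map, coe_univ, Set.image_univ, Set.mem_range] at hx hy
    obtain ⟨a, rfl⟩ := hx
    obtain ⟨b, rfl⟩ := hy
    exact cycleUnion_adj_mk.mpr (hadj _ hi a b fun e => hxy (e ▸ rfl))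

lemma ncard_cycleUnion_cliqueSet_three (hh : ∀ i, 3 ≤ h i) :
    ((cycleUnion m h).cliqueSet 3).ncard = #{i | h i = 3} := by
  rw [cycleUnion_cliqueSet_three hh, Set.InjOn.ncard_image]
  · rw [← Set.ncard_coe_finset]
    simp
  · intro i hi j _ hij
    have h0 : (⟨i, ⟨0, by have := hh i; omega⟩⟩ : Σ i : Fin m, Fin (h i))
        ∈ univ.map (Function.Embedding.sigmaMk (β := fun i => Fin (h i)) j) := by
      have hij' : univ.map (Function.Embedding.sigmaMk (β := fun i => Fin (h i)) i)
        = univ.map (Function.Embedding.sigmaMk j) := hij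
      simp [← hij']
    obtain ⟨b, -, hb⟩ := mem_map.mp h0
    exact (congrArg Sigma.fst hb).symm

/-- A disjoint union of cycles with `3 * k + r` vertices, `r < 3`, has at most `k` triangles as
components, and at most `k - 1` if `r ≠ 0`. -/
lemma card_filter_eq_three_le {k r : ℕ} (hr : r < 3) (hh : ∀ i, 3 ≤ h i)
    (hsum : ∑ i, h i = 3 * k + r) : #{i | h i = 3} ≤ if r = 0 then k else k - 1 := by
  have hm : m * 3 ≤ ∑ i, h i := by
    simpa using Finset.card_nsmul_le_sum univ h 3 fun i _ => hh i
  have hle : #{i | h i = 3} ≤ m := by simpa using Finset.card_filter_le univ fun i => h i = 3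
  by_cases hall : ∀ i, h i = 3
  · have : ∑ i, h i = m * 3 := by simp [hall]
    split_ifs <;> omega
  · have hlt : #{i | h i = 3} < m := by
      simpa using Finset.card_lt_card
        ((Finset.filter_ssubset (s := univ) (p := fun i => h i = 3)).mpr (by simpa using hall))
    split_ifs <;> omega

end CycleUnion

/-- Let `n ≥ 3`, `n = 3k + r` with `0 ≤ r < 3`. Among all disjoint unions
of cycles `C_{h 0} ∪ ⋯ ∪ C_{h (m-1)}` with every `h i ≥ 3` and `Σ h i = n`, the union `G₀`
of `k - 1` copies of `C_3` together with one copy of `C_{3+r}` minimizes the number of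
triangles in the complement. -/
theorem compl_cycleUnion_triangles_minimized
    (n k r : ℕ) (hn : 3 ≤ n) (hnk : n = 3 * k + r) (hr : r < 3)
    (h₀ : Fin k → ℕ) (hh₀ : ∀ i : Fin k, h₀ i = if (i : ℕ) < k - 1 then 3 else 3 + r) :
    ∀ (m : ℕ) (h : Fin m → ℕ), (∀ i, 3 ≤ h i) → ∑ i, h i = n →
      ((cycleUnion k h₀)ᶜ.cliqueSet 3).ncard ≤ ((cycleUnion m h)ᶜ.cliqueSet 3).ncard := by
  intro m h hh hsum
  have hh₀3 : ∀ i, 3 ≤ h₀ i := fun i => by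
    rw [hh₀]
    split_ifs <;> omega
  have hsum₀ : ∑ i, h₀ i = n := by
    obtain ⟨k, rfl⟩ := Nat.exists_eq_add_of_le' (show 1 ≤ k by omega)
    simp [Fin.sum_univ_castSucc, hh₀]
    omega
  have hcard₀ : (if r = 0 then k else k - 1) ≤ #{i | h₀ i = 3} := by
    split_ifs with h0
    · have : ∀ i, h₀ i = 3 := fun i => by simp [hh₀, h0]
      simp [this]
    · obtain ⟨k, rfl⟩ := Nat.exists_eq_add_of_le' (show 1 ≤ k by omega)
      have hsub : univ.map Fin.castSuccEmb ⊆ ({i | h₀ i = 3} : Finset (Fin (k + 1))) := by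
        intro i hi
        obtain ⟨j, -, rfl⟩ := mem_map.mp hi
        simp [hh₀]
      simpa using Finset.card_le_card hsub
  have hcard := (card_filter_eq_three_le hr hh (hsum.trans hnk)).trans hcard₀
  classical
  have e₀ := (cycleUnion_isRegularOfDegree hh₀3).ncard_cliqueSet_add_ncard_cliqueSet_compl
  have e := (cycleUnion_isRegularOfDegree hh).ncard_cliqueSet_add_ncard_cliqueSet_compl
  rw [ncard_cycleUnion_cliqueSet_three hh₀3] at e₀
  rw [ncard_cycleUnion_cliqueSet_three hh] at e
  simp only [Fintype.card_sigma, Fintype.card_fin, hsum₀] at e₀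
  simp only [Fintype.card_sigma, Fintype.card_fin, hsum] at e
  omega
end
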